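/- Let (Ω,F,Pr) carry the self-repelling random walk X with directed edges and weight function w, with natural filtration (F_n). For each j ∈ ℤ define γ_j(l) := min{n ≥ 0 : ℓ⁺(n,j)+ℓ⁻(n,j) ≥ l} and ξ_j(l) := ℓ⁺(γ_j(l),j) − ℓ⁻(γ_j(l),j). Then the processes (l ↦ ξ_j(l))_{j∈ℤ} are independent, and each is a Markov chain on ℤ started at ξ_j(0)=0 with transition probabilities Pr(ξ(l+1)=x+1 | ξ(l)=x) = w(−x)/(w(x)+w(−x)) and Pr(ξ(l+1)=x−1 | ξ(l)=x) = w(x)/(w(x)+w(−x)). -/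

import Mathlib

open MeasureTheory Filter
open scoped BigOperators ENNReal Topology

noncomputable section

/-- The weight function `w` is positive, nondecreasing and satisfies
`lim_{z→∞} (w(z) - w(-z)) > 0`. -/
def GoodWeight (w : ℤ → ℝ) : Prop :=
  (∀ z, 0 < w z) ∧ (∀ z, w z ≤ w (z + 1)) ∧
    ∃ c > (0 : ℝ), ∀ᶠ z : ℤ in atTop, c ≤ w z - w (-z)

/-- Local time of the path `x` on the oriented edge from `k` to `k+1` up to time `n`. -/
def dirLocP (x : ℕ → ℤ) (n : ℕ) (k : ℤ) : ℕ :=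
  ((Finset.range n).filter fun j => x j = k ∧ x (j + 1) = k + 1).card

/-- Local time of the path `x` on the oriented edge from `k` to `k-1` up to time `n`. -/
def dirLocM (x : ℕ → ℤ) (n : ℕ) (k : ℤ) : ℕ :=
  ((Finset.range n).filter fun j => x j = k ∧ x (j + 1) = k - 1).card

/-- The conditional probability, given the past path `x` up to time `n`, that the
self-repelling walk with weight `w` makes the step `x n → x (n+1)`. -/
def stepProb (w : ℤ → ℝ) (x : ℕ → ℤ) (n : ℕ) : ℝ :=
  let Δ : ℤ := (dirLocP x n (x n) : ℤ) - (dirLocM x n (x n) : ℤ)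
  if x (n + 1) = x n + 1 then w (-Δ) / (w Δ + w (-Δ))
  else if x (n + 1) = x n - 1 then w Δ / (w Δ + w (-Δ))
  else 0

/-- `X` is the self-repelling random walk with directed edges and weight function `w`:
it starts at `0` and its cylinder probabilities evolve by the self-repelling
transition probabilities. -/
def IsSRW {Ω : Type*} [MeasurableSpace Ω] (μ : Measure Ω) (w : ℤ → ℝ)
    (X : ℕ → Ω → ℤ) : Prop :=
  (∀ n, Measurable (X n)) ∧
  μ {ω | X 0 ω = 0} = 1 ∧
  ∀ (n : ℕ) (x : ℕ → ℤ),
    μ {ω | ∀ i ≤ n + 1, X i ω = x i} =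
      μ {ω | ∀ i ≤ n, X i ω = x i} * ENNReal.ofReal (stepProb w x n)

/-- Inverse local time `T⁺_{j,r} = min{n ≥ 0 : ℓ⁺(n,j) ≥ r}` of the path `x`. -/
def Tp (x : ℕ → ℤ) (j : ℤ) (r : ℕ) : ℕ := sInf {n | r ≤ dirLocP x n j}

/-- Inverse local time `T⁻_{j,r} = min{n ≥ 0 : ℓ⁻(n,j) ≥ r}` of the path `x`. -/
def Tm (x : ℕ → ℤ) (j : ℤ) (r : ℕ) : ℕ := sInf {n | r ≤ dirLocM x n j}

/-- `Λ⁺_{j,r}(k) = ℓ⁺(T⁺_{j,r},k) + ℓ⁻(T⁺_{j,r},k+1)`. -/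
def LamP (x : ℕ → ℤ) (j : ℤ) (r : ℕ) (k : ℤ) : ℕ :=
  dirLocP x (Tp x j r) k + dirLocM x (Tp x j r) (k + 1)

/-- `Λ⁻_{j,r}(k) = ℓ⁺(T⁻_{j,r},k) + ℓ⁻(T⁻_{j,r},k+1)`. -/
def LamM (x : ℕ → ℤ) (j : ℤ) (r : ℕ) (k : ℤ) : ℕ :=
  dirLocP x (Tm x j r) k + dirLocM x (Tm x j r) (k + 1)

/-- Leftmost edge `λ⁺_{j,r}` visited before `T⁺_{j,r}`. -/
def lamEdgeP (x : ℕ → ℤ) (j : ℤ) (r : ℕ) : ℤ := sInf {k : ℤ | 0 < LamP x j r k}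

/-- Leftmost edge `λ⁻_{j,r}` visited before `T⁻_{j,r}`. -/
def lamEdgeM (x : ℕ → ℤ) (j : ℤ) (r : ℕ) : ℤ := sInf {k : ℤ | 0 < LamM x j r k}

/-- Rightmost edge `ρ⁺_{j,r}` visited before `T⁺_{j,r}`. -/
def rhoEdgeP (x : ℕ → ℤ) (j : ℤ) (r : ℕ) : ℤ := sSup {k : ℤ | 0 < LamP x j r k}

/-- Rightmost edge `ρ⁻_{j,r}` visited before `T⁻_{j,r}`. -/
def rhoEdgeM (x : ℕ → ℤ) (j : ℤ) (r : ℕ) : ℤ := sSup {k : ℤ | 0 < LamM x j r k}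

/-- `γ_j(l) := min{n ≥ 0 : ℓ⁺(n,j) + ℓ⁻(n,j) ≥ l}`, the time of the `l`-th jump out of `j`. -/
def gammaT (x : ℕ → ℤ) (j : ℤ) (l : ℕ) : ℕ :=
  sInf {n | l ≤ dirLocP x n j + dirLocM x n j}

/-- `ξ_j(l) := ℓ⁺(γ_j(l),j) - ℓ⁻(γ_j(l),j)`. -/
def xiProc (x : ℕ → ℤ) (j : ℤ) (l : ℕ) : ℤ :=
  (dirLocP x (gammaT x j l) j : ℤ) - (dirLocM x (gammaT x j l) j : ℤ)

/-- The transition kernel of the auxiliary Markov chain `ξ`: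
it jumps up with probability `w(-x)/(w(x)+w(-x))` and down with probability
`w(x)/(w(x)+w(-x))`. -/
def XiKer (w : ℤ → ℝ) (a b : ℤ) : ℝ :=
  if b = a + 1 then w (-a) / (w a + w (-a))
  else if b = a - 1 then w a / (w a + w (-a))
  else 0

/-- The up-step probability out of a site at which the local-time difference is `a`. -/
def upProb (w : ℤ → ℝ) (a : ℤ) : ℝ := w (-a) / (w a + w (-a))

/-- The down-step probability out of a site at which the local-time difference is `a`. -/
def downProb (w : ℤ → ℝ) (a : ℤ) : ℝ := w a / (w a + w (-a))

/-- The difference of the directed local times at the site `k`. -/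
def locDiff (x : ℕ → ℤ) (n : ℕ) (k : ℤ) : ℤ := (dirLocP x n k : ℤ) - (dirLocM x n k : ℤ)

/-- The path `x` with its position at time `n + 1` replaced by `x n + 1`. -/
def stepUp (x : ℕ → ℤ) (n : ℕ) : ℕ → ℤ := Function.update x (n + 1) (x n + 1)

/-- The path `x` with its position at time `n + 1` replaced by `x n - 1`. -/
def stepDown (x : ℕ → ℤ) (n : ℕ) : ℕ → ℤ := Function.update x (n + 1) (x n - 1)

lemma upProb_nonneg {w : ℤ → ℝ} (hw : ∀ z, 0 < w z) (a : ℤ) : 0 ≤ upProb w a :=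
  div_nonneg (hw _).le (add_pos (hw _) (hw _)).le

lemma downProb_pos {w : ℤ → ℝ} (hw : ∀ z, 0 < w z) (a : ℤ) : 0 < downProb w a :=
  div_pos (hw _) (add_pos (hw _) (hw _))

lemma upProb_pos {w : ℤ → ℝ} (hw : ∀ z, 0 < w z) (a : ℤ) : 0 < upProb w a :=
  div_pos (hw _) (add_pos (hw _) (hw _))

lemma upProb_add_downProb {w : ℤ → ℝ} (hw : ∀ z, 0 < w z) (a : ℤ) :
    upProb w a + downProb w a = 1 := by
  have := add_pos (hw a) (hw (-a))
  rw [upProb, downProb, ← add_div, add_comm (w (-a)), div_self this.ne']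

lemma upProb_neg (w : ℤ → ℝ) (a : ℤ) : upProb w (-a) = downProb w a := by
  simp [upProb, downProb, add_comm]

lemma downProb_neg (w : ℤ → ℝ) (a : ℤ) : downProb w (-a) = upProb w a := by
  simp [upProb, downProb, add_comm]

lemma downProb_mono {w : ℤ → ℝ} (hw : ∀ z, 0 < w z) (hm : Monotone w) :
    Monotone (downProb w) := by
  intro a b hab
  have h1 := hm hab
  have h2 := hm (neg_le_neg hab)
  rw [downProb, downProb, div_le_div_iff₀ (add_pos (hw _) (hw _)) (add_pos (hw _) (hw _))]
  nlinarith [hw a, hw b, hw (-a), hw (-b), mul_le_mul h1 h2 (hw _).le (hw _).le]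

lemma upProb_le_downProb {w : ℤ → ℝ} (hw : ∀ z, 0 < w z) (hm : Monotone w) {a : ℤ}
    (ha : 0 ≤ a) : upProb w a ≤ downProb w a := by
  rw [← downProb_neg]
  exact downProb_mono hw hm (by omega)

lemma downProb_lt_one {w : ℤ → ℝ} (hw : ∀ z, 0 < w z) (a : ℤ) : downProb w a < 1 := by
  linarith [upProb_add_downProb hw a, upProb_pos hw a]

section LocalTimes

lemma dirLocP_congr {x y : ℕ → ℤ} {n : ℕ} (h : ∀ i ≤ n, x i = y i) (k : ℤ) :
    dirLocP x n k = dirLocP y n k := by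
  unfold dirLocP
  congr 1
  apply Finset.filter_congr
  intro i hi
  rw [Finset.mem_range] at hi
  rw [h i (by omega), h (i + 1) (by omega)]

lemma dirLocM_congr {x y : ℕ → ℤ} {n : ℕ} (h : ∀ i ≤ n, x i = y i) (k : ℤ) :
    dirLocM x n k = dirLocM y n k := by
  unfold dirLocM
  congr 1
  apply Finset.filter_congr
  intro i hi
  rw [Finset.mem_range] at hi
  rw [h i (by omega), h (i + 1) (by omega)]

lemma locDiff_congr {x y : ℕ → ℤ} {n : ℕ} (h : ∀ i ≤ n, x i = y i) (k : ℤ) :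
    locDiff x n k = locDiff y n k := by
  rw [locDiff, locDiff, dirLocP_congr h, dirLocM_congr h]

lemma dirLocP_zero (x : ℕ → ℤ) (k : ℤ) : dirLocP x 0 k = 0 := rfl

lemma dirLocM_zero (x : ℕ → ℤ) (k : ℤ) : dirLocM x 0 k = 0 := rfl

lemma dirLocP_succ (x : ℕ → ℤ) (n : ℕ) (k : ℤ) :
    dirLocP x (n + 1) k = dirLocP x n k + if x n = k ∧ x (n + 1) = k + 1 then 1 else 0 := by
  unfold dirLocP
  rw [Finset.range_add_one, Finset.filter_insert]
  split_ifs with h <;> simp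

lemma dirLocM_succ (x : ℕ → ℤ) (n : ℕ) (k : ℤ) :
    dirLocM x (n + 1) k = dirLocM x n k + if x n = k ∧ x (n + 1) = k - 1 then 1 else 0 := by
  unfold dirLocM
  rw [Finset.range_add_one, Finset.filter_insert]
  split_ifs with h <;> simp

lemma dirLocP_mono (x : ℕ → ℤ) (k : ℤ) : Monotone fun n => dirLocP x n k :=
  monotone_nat_of_le_succ fun n => by simp [dirLocP_succ]

lemma dirLocM_mono (x : ℕ → ℤ) (k : ℤ) : Monotone fun n => dirLocM x n k :=
  monotone_nat_of_le_succ fun n => by simp [dirLocM_succ]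

lemma dirLocP_neg (x : ℕ → ℤ) (n : ℕ) (k : ℤ) :
    dirLocP (fun i => -x i) n k = dirLocM x n (-k) := by
  unfold dirLocP dirLocM
  congr 1
  apply Finset.filter_congr
  intro i _
  dsimp only
  omega

lemma dirLocM_neg (x : ℕ → ℤ) (n : ℕ) (k : ℤ) :
    dirLocM (fun i => -x i) n k = dirLocP x n (-k) := by
  unfold dirLocP dirLocM
  congr 1
  apply Finset.filter_congr
  intro i _
  dsimp only
  omega

lemma stepUp_of_le (x : ℕ → ℤ) {n i : ℕ} (h : i ≤ n) : stepUp x n i = x i := by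
  rw [stepUp, Function.update_of_ne (by omega)]

lemma stepDown_of_le (x : ℕ → ℤ) {n i : ℕ} (h : i ≤ n) : stepDown x n i = x i := by
  rw [stepDown, Function.update_of_ne (by omega)]

lemma stepUp_succ (x : ℕ → ℤ) (n : ℕ) : stepUp x n (n + 1) = x n + 1 := by
  simp [stepUp]

lemma stepDown_succ (x : ℕ → ℤ) (n : ℕ) : stepDown x n (n + 1) = x n - 1 := by
  simp [stepDown]

lemma dirLocP_stepUp_of_le (x : ℕ → ℤ) {n i : ℕ} (h : i ≤ n) (k : ℤ) :
    dirLocP (stepUp x n) i k = dirLocP x i k :=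
  dirLocP_congr (fun _ hi => stepUp_of_le x (hi.trans h)) k

lemma dirLocM_stepUp_of_le (x : ℕ → ℤ) {n i : ℕ} (h : i ≤ n) (k : ℤ) :
    dirLocM (stepUp x n) i k = dirLocM x i k :=
  dirLocM_congr (fun _ hi => stepUp_of_le x (hi.trans h)) k

lemma dirLocP_stepDown_of_le (x : ℕ → ℤ) {n i : ℕ} (h : i ≤ n) (k : ℤ) :
    dirLocP (stepDown x n) i k = dirLocP x i k :=
  dirLocP_congr (fun _ hi => stepDown_of_le x (hi.trans h)) k

lemma dirLocM_stepDown_of_le (x : ℕ → ℤ) {n i : ℕ} (h : i ≤ n) (k : ℤ) :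
    dirLocM (stepDown x n) i k = dirLocM x i k :=
  dirLocM_congr (fun _ hi => stepDown_of_le x (hi.trans h)) k

lemma dirLocP_stepUp (x : ℕ → ℤ) (n : ℕ) (k : ℤ) :
    dirLocP (stepUp x n) (n + 1) k = dirLocP x n k + if x n = k then 1 else 0 := by
  rw [dirLocP_succ, dirLocP_stepUp_of_le x le_rfl, stepUp_succ, stepUp_of_le x le_rfl]
  congr 2
  rw [eq_iff_iff]
  omega

lemma dirLocM_stepUp (x : ℕ → ℤ) (n : ℕ) (k : ℤ) :
    dirLocM (stepUp x n) (n + 1) k = dirLocM x n k := by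
  rw [dirLocM_succ, dirLocM_stepUp_of_le x le_rfl, stepUp_succ, stepUp_of_le x le_rfl,
    if_neg (by omega), add_zero]

lemma dirLocP_stepDown (x : ℕ → ℤ) (n : ℕ) (k : ℤ) :
    dirLocP (stepDown x n) (n + 1) k = dirLocP x n k := by
  rw [dirLocP_succ, dirLocP_stepDown_of_le x le_rfl, stepDown_succ, stepDown_of_le x le_rfl,
    if_neg (by omega), add_zero]

lemma dirLocM_stepDown (x : ℕ → ℤ) (n : ℕ) (k : ℤ) :
    dirLocM (stepDown x n) (n + 1) k = dirLocM x n k + if x n = k then 1 else 0 := by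
  rw [dirLocM_succ, dirLocM_stepDown_of_le x le_rfl, stepDown_succ, stepDown_of_le x le_rfl]
  congr 2
  rw [eq_iff_iff]
  omega

end LocalTimes

section OneStep

variable {Ω : Type*} [MeasurableSpace Ω] {μ : Measure Ω} {w : ℤ → ℝ} {X : ℕ → Ω → ℤ}

/-- Extend a finite path by zero. -/
def extendPath {n : ℕ} (c : Fin (n + 1) → ℤ) (i : ℕ) : ℤ :=
  if h : i < n + 1 then c ⟨i, h⟩ else 0

lemma extendPath_of_le {n : ℕ} (x : ℕ → ℤ) {i : ℕ} (h : i ≤ n) :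
    extendPath (fun j : Fin (n + 1) => x j) i = x i := by
  simp [extendPath, Nat.lt_succ_of_le h]

lemma lintegral_comp_countable {C : Type*} [Countable C] [MeasurableSpace C]
    [MeasurableSingletonClass C] {Y : Ω → C} (hY : Measurable Y) (g : C → ℝ≥0∞) :
    ∫⁻ ω, g (Y ω) ∂μ = ∑' c, g c * μ (Y ⁻¹' {c}) := by
  rw [← lintegral_map (measurable_of_countable g) hY, lintegral_countable']
  simp_rw [Measure.map_apply hY (measurableSet_singleton _)]

lemma measurable_of_dependsOn (hX : ∀ n, Measurable (X n)) {β : Type*} [MeasurableSpace β]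
    (n : ℕ) (F : (ℕ → ℤ) → β) (hF : ∀ x y : ℕ → ℤ, (∀ i ≤ n, x i = y i) → F x = F y) :
    Measurable fun ω => F fun i => X i ω := by
  have h : (fun ω => F fun i => X i ω) =
      (fun c : Fin (n + 1) → ℤ => F (extendPath c)) ∘ fun ω (i : Fin (n + 1)) => X i ω := by
    funext ω
    exact hF _ _ fun i hi => (extendPath_of_le (fun i => X i ω) hi).symm
  rw [h]
  exact (measurable_of_countable _).comp (measurable_pi_lambda _ fun i => hX i)

lemma stepProb_eq (w : ℤ → ℝ) (x : ℕ → ℤ) (n : ℕ) :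
    stepProb w x n = if x (n + 1) = x n + 1 then upProb w (locDiff x n (x n))
      else if x (n + 1) = x n - 1 then downProb w (locDiff x n (x n)) else 0 := rfl

/-- The one-step conditional expectation formula for the walk. -/
lemma lintegral_step (hw : ∀ z, 0 < w z) (hX : IsSRW μ w X) (n : ℕ) (F : (ℕ → ℤ) → ℝ)
    (hF0 : ∀ x, 0 ≤ F x)
    (hF : ∀ x y : ℕ → ℤ, (∀ i ≤ n + 1, x i = y i) → F x = F y) :
    ∫⁻ ω, ENNReal.ofReal (F fun i => X i ω) ∂μ =
      ∫⁻ ω, ENNReal.ofReal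
        (upProb w (locDiff (fun i => X i ω) n (X n ω)) * F (stepUp (fun i => X i ω) n) +
        downProb w (locDiff (fun i => X i ω) n (X n ω)) * F (stepDown (fun i => X i ω) n)) ∂μ := by
  obtain ⟨hm, -, hstep⟩ := hX
  set H : (ℕ → ℤ) → ℝ := fun x =>
    upProb w (locDiff x n (x n)) * F (stepUp x n) +
      downProb w (locDiff x n (x n)) * F (stepDown x n) with hH
  have hHc : ∀ x y : ℕ → ℤ, (∀ i ≤ n, x i = y i) → H x = H y := by
    intro x y hxy
    have h1 : F (stepUp x n) = F (stepUp y n) := by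
      apply hF
      intro i hi
      rcases Nat.lt_or_ge n i with h | h
      · obtain rfl : i = n + 1 := by omega
        rw [stepUp_succ, stepUp_succ, hxy n le_rfl]
      · rw [stepUp_of_le _ h, stepUp_of_le _ h, hxy i h]
    have h2 : F (stepDown x n) = F (stepDown y n) := by
      apply hF
      intro i hi
      rcases Nat.lt_or_ge n i with h | h
      · obtain rfl : i = n + 1 := by omega
        rw [stepDown_succ, stepDown_succ, hxy n le_rfl]
      · rw [stepDown_of_le _ h, stepDown_of_le _ h, hxy i h]
    simp only [hH]
    rw [h1, h2, hxy n le_rfl, locDiff_congr hxy]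
  have hY : Measurable fun ω (i : Fin (n + 1)) => X i ω := measurable_pi_lambda _ fun i => hm i
  have hL : ∀ ω, ENNReal.ofReal (F fun i => X i ω) =
      (fun p : (Fin (n + 1) → ℤ) × ℤ =>
        ENNReal.ofReal (F (Function.update (extendPath p.1) (n + 1) p.2)))
        ((fun i : Fin (n + 1) => X i ω), X (n + 1) ω) := by
    intro ω
    dsimp only
    congr 1
    apply hF
    intro i hi
    rcases Nat.lt_or_ge n i with h | h
    · obtain rfl : i = n + 1 := by omega
      simp
    · rw [Function.update_of_ne (by omega), extendPath_of_le (fun i => X i ω) h]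
  have hR : ∀ ω, ENNReal.ofReal (H fun i => X i ω) =
      (fun c : Fin (n + 1) → ℤ => ENNReal.ofReal (H (extendPath c)))
        (fun i : Fin (n + 1) => X i ω) := fun ω => by
    dsimp only
    congr 1
    exact hHc _ _ fun i hi => (extendPath_of_le (fun i => X i ω) hi).symm
  calc _ = _ := lintegral_congr hL
    _ = _ := lintegral_comp_countable (hY.prodMk (hm (n + 1)))
          fun p : (Fin (n + 1) → ℤ) × ℤ =>
            ENNReal.ofReal (F (Function.update (extendPath p.1) (n + 1) p.2))
    _ = ∑' c : Fin (n + 1) → ℤ, ENNReal.ofReal (H (extendPath c)) *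
          μ ((fun ω (i : Fin (n + 1)) => X i ω) ⁻¹' {c}) := ?_
    _ = _ := (lintegral_comp_countable hY
          fun c : Fin (n + 1) → ℤ => ENNReal.ofReal (H (extendPath c))).symm
    _ = _ := (lintegral_congr hR).symm
  rw [ENNReal.tsum_prod']
  refine tsum_congr fun c => ?_
  set x := extendPath c with hx
  have hc : ∀ s : ℤ, μ ((fun ω => ((fun i : Fin (n + 1) => X i ω), X (n + 1) ω)) ⁻¹' {(c, s)}) =
      μ ((fun ω (i : Fin (n + 1)) => X i ω) ⁻¹' {c}) *
        ENNReal.ofReal (stepProb w (Function.update x (n + 1) s) n) := by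
    intro s
    have h1 := hstep n (Function.update x (n + 1) s)
    have hA : (fun ω (i : Fin (n + 1)) => X i ω) ⁻¹' {c} =
        {ω | ∀ i ≤ n, X i ω = Function.update x (n + 1) s i} := by
      ext ω
      simp only [Set.mem_preimage, Set.mem_singleton_iff, Set.mem_ofPred_eq, funext_iff]
      constructor
      · intro h i hi
        rw [Function.update_of_ne (by omega), hx, extendPath, dif_pos (by omega)]
        exact h ⟨i, by omega⟩
      · intro h i
        rw [h i (by omega), Function.update_of_ne (by omega), hx, extendPath, dif_pos i.2]
    have hB : (fun ω => ((fun i : Fin (n + 1) => X i ω), X (n + 1) ω)) ⁻¹' {(c, s)} =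
        {ω | ∀ i ≤ n + 1, X i ω = Function.update x (n + 1) s i} := by
      ext ω
      have := Set.ext_iff.1 hA ω
      simp only [Set.mem_preimage, Set.mem_singleton_iff, Set.mem_ofPred_eq, Prod.mk.injEq] at this ⊢
      rw [this]
      constructor
      · rintro ⟨h, h'⟩ i hi
        rcases Nat.lt_or_ge n i with h2 | h2
        · obtain rfl : i = n + 1 := by omega
          simpa using h'
        · exact h i h2
      · intro h
        exact ⟨fun i hi => h i (by omega), by simpa using h (n + 1) le_rfl⟩
    rw [hA, hB, h1]
  simp_rw [hc]
  have hd : ∀ s, locDiff (Function.update x (n + 1) s) n (x n) = locDiff x n (x n) := fun s =>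
    locDiff_congr (fun i hi => by rw [Function.update_of_ne (by omega)]) _
  rw [tsum_eq_sum (s := {x n + 1, x n - 1})]
  · rw [Finset.sum_pair (by omega)]
    simp only [stepProb_eq, Function.update_self, Function.update_of_ne (Nat.succ_ne_self n).symm,
      hd, if_true]
    rw [if_neg (by omega), ENNReal.ofReal_add
      (mul_nonneg (upProb_nonneg hw _) (hF0 _)) (mul_nonneg (downProb_pos hw _).le (hF0 _)),
      ENNReal.ofReal_mul (upProb_nonneg hw _), ENNReal.ofReal_mul (downProb_pos hw _).le]
    simp only [stepUp, stepDown]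
    ring
  · intro s hs
    simp only [Finset.mem_insert, Finset.mem_singleton, not_or] at hs
    simp only [stepProb_eq, Function.update_self, Function.update_of_ne (Nat.succ_ne_self n).symm]
    rw [if_neg hs.1, if_neg hs.2]
    simp

end OneStep

/-- A path all of whose steps are `±1`. -/
def IsNearestNeighbour (x : ℕ → ℤ) : Prop := ∀ n, x (n + 1) = x n + 1 ∨ x (n + 1) = x n - 1

section Consequences

variable {Ω : Type*} [MeasurableSpace Ω] {μ : Measure Ω} {w : ℤ → ℝ} {X : ℕ → Ω → ℤ}

lemma lintegral_step_eq (hw : ∀ z, 0 < w z) (hX : IsSRW μ w X) (n : ℕ) (F G : (ℕ → ℤ) → ℝ)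
    (hF0 : ∀ x, 0 ≤ F x)
    (hF : ∀ x y : ℕ → ℤ, (∀ i ≤ n + 1, x i = y i) → F x = F y)
    (hFG : ∀ x, upProb w (locDiff x n (x n)) * F (stepUp x n) +
      downProb w (locDiff x n (x n)) * F (stepDown x n) = G x) :
    ∫⁻ ω, ENNReal.ofReal (F fun i => X i ω) ∂μ = ∫⁻ ω, ENNReal.ofReal (G fun i => X i ω) ∂μ := by
  rw [lintegral_step hw hX n F hF0 hF]
  simp_rw [← hFG]

lemma lintegral_step_le (hw : ∀ z, 0 < w z) (hX : IsSRW μ w X) (n : ℕ) (F G : (ℕ → ℤ) → ℝ)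
    (hF0 : ∀ x, 0 ≤ F x)
    (hF : ∀ x y : ℕ → ℤ, (∀ i ≤ n + 1, x i = y i) → F x = F y)
    (hFG : ∀ x, upProb w (locDiff x n (x n)) * F (stepUp x n) +
      downProb w (locDiff x n (x n)) * F (stepDown x n) ≤ G x) :
    ∫⁻ ω, ENNReal.ofReal (F fun i => X i ω) ∂μ ≤ ∫⁻ ω, ENNReal.ofReal (G fun i => X i ω) ∂μ := by
  rw [lintegral_step hw hX n F hF0 hF]
  exact lintegral_mono fun ω => ENNReal.ofReal_le_ofReal (hFG _)

lemma IsSRW.ae_isNearestNeighbour (hw : ∀ z, 0 < w z) (hX : IsSRW μ w X) :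
    ∀ᵐ ω ∂μ, IsNearestNeighbour fun n => X n ω := by
  refine ae_all_iff.2 fun n => ?_
  have hc : ∀ x y : ℕ → ℤ, (∀ i ≤ n + 1, x i = y i) →
      (if x (n + 1) = x n + 1 ∨ x (n + 1) = x n - 1 then (0 : ℝ) else 1) =
      if y (n + 1) = y n + 1 ∨ y (n + 1) = y n - 1 then (0 : ℝ) else 1 := by
    intro x y h
    rw [h n (by omega), h (n + 1) le_rfl]
  have h := lintegral_step_eq hw hX n
    (fun x => if x (n + 1) = x n + 1 ∨ x (n + 1) = x n - 1 then (0 : ℝ) else 1) (fun _ => 0)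
    (fun x => by positivity) hc
    (fun x => by simp [stepUp_succ, stepDown_succ, stepUp_of_le, stepDown_of_le])
  simp only [ENNReal.ofReal_zero, lintegral_zero] at h
  rw [lintegral_eq_zero_iff] at h
  · filter_upwards [h] with ω hω
    by_contra hcon
    simp [hcon] at hω
  · exact (measurable_of_dependsOn hX.1 (n + 1)
      (fun x => if x (n + 1) = x n + 1 ∨ x (n + 1) = x n - 1 then (0 : ℝ) else 1) hc).ennreal_ofReal

lemma IsSRW.ae_zero [IsProbabilityMeasure μ] (hX : IsSRW μ w X) : ∀ᵐ ω ∂μ, X 0 ω = 0 := by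
  have : MeasurableSet {ω | X 0 ω = 0} := hX.1 0 (measurableSet_singleton 0)
  exact (prob_compl_eq_zero_iff this).2 hX.2.1

/-- The reflected walk is a walk with the same weight function. -/
lemma IsSRW.neg (hX : IsSRW μ w X) : IsSRW μ w fun n ω => -X n ω := by
  obtain ⟨hm, h0, hs⟩ := hX
  refine ⟨fun n => (hm n).neg, by simpa using h0, fun n x => ?_⟩
  have h := hs n fun i => -x i
  have hp : stepProb w (fun i => -x i) n = stepProb w x n := by
    have hd : locDiff (fun i => -x i) n (-x n) = -locDiff x n (x n) := by
      rw [locDiff, locDiff, dirLocP_neg, dirLocM_neg, neg_neg]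
      ring
    rw [stepProb_eq, stepProb_eq, hd, upProb_neg, downProb_neg]
    split_ifs <;> first | rfl | omega
  rw [hp] at h
  simpa only [neg_eq_iff_eq_neg] using h

/-- If the events `A n` have probability at most `ε`, so does the event that `A n` occurs for
all large `n`. -/
lemma measure_eventually_le {A : ℕ → Set Ω} {ε : ℝ≥0∞} (n₀ : ℕ) (hA : ∀ n ≥ n₀, μ (A n) ≤ ε) :
    μ {ω | ∀ᶠ n in atTop, ω ∈ A n} ≤ ε := by
  have h : {ω | ∀ᶠ n in atTop, ω ∈ A n} ⊆ ⋃ n, ⋂ m ≥ n, A m := by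
    intro ω hω
    obtain ⟨N, hN⟩ := eventually_atTop.1 hω
    simp only [Set.mem_iUnion, Set.mem_iInter]
    exact ⟨N, hN⟩
  refine (measure_mono h).trans ?_
  rw [Monotone.measure_iUnion]
  · refine iSup_le fun n => (measure_mono ?_).trans (hA (max n n₀) (le_max_right _ _))
    exact Set.biInter_subset_of_mem (le_max_left n n₀)
  · intro a b hab ω hω
    simp only [Set.mem_iInter] at hω ⊢
    exact fun m hm => hω m (hab.trans hm)

end Consequences

section Escape

variable {Ω : Type*} [MeasurableSpace Ω] {μ : Measure Ω} {w : ℤ → ℝ} {X : ℕ → Ω → ℤ}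

/-- A function that is at least one on `A` has integral at least `μ A`. -/
lemma measure_le_lintegral_of_one_le {f : Ω → ℝ≥0∞} (hf : Measurable f) {A : Set Ω}
    (h : ∀ ω ∈ A, 1 ≤ f ω) : μ A ≤ ∫⁻ ω, f ω ∂μ :=
  calc μ A ≤ μ {ω | 1 ≤ f ω} := measure_mono h
    _ = 1 * μ {ω | 1 ≤ f ω} := (one_mul _).symm
    _ ≤ _ := mul_meas_ge_le_lintegral hf 1

/-- The supermartingale penalising down-steps at `j` after time `n₀`, killed at the first
up-step at `j` after time `n₀`. -/
def downPenalty (q : ℝ) (j : ℤ) (n₀ n : ℕ) (x : ℕ → ℤ) : ℝ :=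
  if dirLocP x n j = dirLocP x n₀ j then (q ^ (dirLocM x n j - dirLocM x n₀ j))⁻¹ else 0

lemma downPenalty_nonneg {q : ℝ} (hq : 0 ≤ q) (j : ℤ) (n₀ n : ℕ) (x : ℕ → ℤ) :
    0 ≤ downPenalty q j n₀ n x := by
  unfold downPenalty
  positivity

lemma downPenalty_congr (q : ℝ) (j : ℤ) {n₀ n : ℕ} (hn : n₀ ≤ n) (x y : ℕ → ℤ)
    (h : ∀ i ≤ n, x i = y i) : downPenalty q j n₀ n x = downPenalty q j n₀ n y := by
  unfold downPenalty
  rw [dirLocP_congr h, dirLocM_congr h, dirLocP_congr fun i hi => h i (hi.trans hn),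
    dirLocM_congr fun i hi => h i (hi.trans hn)]

lemma dirLocP_le (x : ℕ → ℤ) (n : ℕ) (k : ℤ) : dirLocP x n k ≤ n :=
  (Finset.card_filter_le _ _).trans (Finset.card_range n).le

lemma downPenalty_step (hw : ∀ z, 0 < w z) (hm : Monotone w) (j : ℤ) {n₀ n : ℕ} (hn : n₀ ≤ n)
    (x : ℕ → ℤ) :
    upProb w (locDiff x n (x n)) * downPenalty (downProb w n₀) j n₀ (n + 1) (stepUp x n) +
      downProb w (locDiff x n (x n)) * downPenalty (downProb w n₀) j n₀ (n + 1) (stepDown x n)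
      ≤ downPenalty (downProb w n₀) j n₀ n x := by
  unfold downPenalty
  rw [dirLocP_stepUp, dirLocM_stepUp, dirLocP_stepDown, dirLocM_stepDown,
    dirLocP_stepUp_of_le x hn, dirLocM_stepUp_of_le x hn, dirLocP_stepDown_of_le x hn,
    dirLocM_stepDown_of_le x hn]
  have hPm : dirLocP x n₀ j ≤ dirLocP x n j := dirLocP_mono x j hn
  have hMm : dirLocM x n₀ j ≤ dirLocM x n j := dirLocM_mono x j hn
  by_cases hj : x n = j
  · simp only [hj, if_true]
    rw [if_neg (by omega), mul_zero, zero_add]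
    split_ifs with h
    · have hle : locDiff x n j ≤ (n₀ : ℤ) := by
        have := dirLocP_le x n₀ j
        unfold locDiff
        omega
      rw [show dirLocM x n j + 1 - dirLocM x n₀ j = dirLocM x n j - dirLocM x n₀ j + 1 by omega,
        pow_succ, mul_inv, mul_comm, mul_assoc]
      refine mul_le_of_le_one_right (inv_nonneg.2 (pow_nonneg (downProb_pos hw _).le _)) ?_
      rw [inv_mul_le_iff₀ (downProb_pos hw _), mul_one]
      exact downProb_mono hw hm hle
    · simp
  · simp only [hj, if_false, add_zero]
    rw [← add_mul, upProb_add_downProb hw, one_mul]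

lemma lintegral_downPenalty_le [IsProbabilityMeasure μ] (hw : ∀ z, 0 < w z) (hm : Monotone w)
    (hX : IsSRW μ w X) (j : ℤ) (n₀ t : ℕ) :
    ∫⁻ ω, ENNReal.ofReal (downPenalty (downProb w n₀) j n₀ (n₀ + t) fun i => X i ω) ∂μ ≤ 1 := by
  induction t with
  | zero => simp [downPenalty]
  | succ t ih =>
    refine le_trans ?_ ih
    exact lintegral_step_le hw hX (n₀ + t) _ _
      (fun x => downPenalty_nonneg (downProb_pos hw _).le _ _ _ _)
      (downPenalty_congr _ _ (by omega)) (downPenalty_step hw hm j (by omega))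

/-- Almost surely, a site visited infinitely often emits infinitely many up-steps. -/
lemma IsSRW.ae_frequently_up [IsProbabilityMeasure μ] (hw : ∀ z, 0 < w z) (hm : Monotone w)
    (hX : IsSRW μ w X) :
    ∀ᵐ ω ∂μ, ∀ j : ℤ, (∃ᶠ n in atTop, X n ω = j) →
      ∃ᶠ n in atTop, X n ω = j ∧ X (n + 1) ω = j + 1 := by
  have key : ∀ (j : ℤ) (n₀ : ℕ), ∀ᵐ ω ∂μ, ¬ (Tendsto (fun n => dirLocM (fun i => X i ω) n j)
      atTop atTop ∧
      ∀ᶠ n in atTop, dirLocP (fun i => X i ω) n j = dirLocP (fun i => X i ω) n₀ j) := by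
    intro j n₀
    have hq0 := downProb_pos hw n₀
    have hq1 := downProb_lt_one hw n₀
    rw [ae_iff]
    simp only [not_not]
    have hb : ∀ t : ℕ, μ {ω | Tendsto (fun n => dirLocM (fun i => X i ω) n j) atTop atTop ∧
        ∀ᶠ n in atTop, dirLocP (fun i => X i ω) n j = dirLocP (fun i => X i ω) n₀ j} ≤
        ENNReal.ofReal (downProb w n₀ ^ t) := by
      intro t
      set A : ℕ → Set Ω := fun n => {ω | dirLocM (fun i => X i ω) n₀ j + t ≤
        dirLocM (fun i => X i ω) n j ∧
        dirLocP (fun i => X i ω) n j = dirLocP (fun i => X i ω) n₀ j} with hA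
      have hAn : ∀ n ≥ n₀, μ (A n) ≤ ENNReal.ofReal (downProb w n₀ ^ t) := by
        intro n hn
        obtain ⟨s, rfl⟩ := Nat.exists_eq_add_of_le hn
        have hmeas := (measurable_of_dependsOn hX.1 (n₀ + s) _
          (downPenalty_congr (downProb w n₀) j (by omega : n₀ ≤ n₀ + s))).ennreal_ofReal
        have h1 : μ (A (n₀ + s)) ≤ ∫⁻ ω, ENNReal.ofReal (downProb w n₀ ^ t) *
            ENNReal.ofReal (downPenalty (downProb w n₀) j n₀ (n₀ + s) fun i => X i ω) ∂μ := by
          refine measure_le_lintegral_of_one_le (hmeas.const_mul _) ?_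
          rintro ω ⟨h1, h2⟩
          rw [← ENNReal.ofReal_mul (by positivity), ENNReal.one_le_ofReal, downPenalty, if_pos h2,
            ← div_eq_mul_inv, one_le_div (by positivity)]
          exact pow_le_pow_of_le_one hq0.le hq1.le (by omega)
        rw [lintegral_const_mul _ hmeas] at h1
        exact h1.trans (mul_le_of_le_one_right' (lintegral_downPenalty_le hw hm hX j n₀ s))
      refine (measure_mono ?_).trans (measure_eventually_le n₀ hAn)
      rintro ω ⟨h1, h2⟩
      filter_upwards [h1.eventually_ge_atTop (dirLocM (fun i => X i ω) n₀ j + t), h2] with n h3 h4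
      exact ⟨h3, h4⟩
    have hlim : Tendsto (fun t : ℕ => ENNReal.ofReal (downProb w n₀ ^ t)) atTop (𝓝 0) := by
      rw [← ENNReal.ofReal_zero]
      exact ENNReal.tendsto_ofReal (tendsto_pow_atTop_nhds_zero_of_lt_one hq0.le hq1)
    exact le_antisymm (ge_of_tendsto' hlim hb) bot_le
  filter_upwards [ae_all_iff.2 fun j => ae_all_iff.2 (key j), hX.ae_isNearestNeighbour hw]
    with ω hω hnn j hj
  by_contra hcon
  rw [not_frequently] at hcon
  obtain ⟨n₀, hn₀⟩ := eventually_atTop.1 hcon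
  refine hω j n₀ ⟨?_, ?_⟩
  · refine tendsto_atTop_atTop_of_monotone (dirLocM_mono _ j) fun b => ?_
    induction b with
    | zero => exact ⟨0, by simp⟩
    | succ b ih =>
      obtain ⟨a, ha⟩ := ih
      obtain ⟨n, hn, hxn⟩ := frequently_atTop.1 hj (max a n₀)
      refine ⟨n + 1, ?_⟩
      have h1 : dirLocM (fun i => X i ω) a j ≤ dirLocM (fun i => X i ω) n j :=
        dirLocM_mono _ j (le_of_max_le_left hn)
      have h2 := hn₀ n (le_of_max_le_right hn)
      have h3 := hnn n
      simp only at h3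
      rw [dirLocM_succ, if_pos]
      · omega
      · exact ⟨hxn, by omega⟩
  · refine eventually_atTop.2 ⟨n₀, fun n hn => ?_⟩
    induction n, hn using Nat.le_induction with
    | base => rfl
    | succ n hn ih => rw [dirLocP_succ, if_neg (hn₀ n hn), ih, add_zero]

/-- Almost surely, a site visited infinitely often emits infinitely many down-steps. -/
lemma IsSRW.ae_frequently_down [IsProbabilityMeasure μ] (hw : ∀ z, 0 < w z) (hm : Monotone w)
    (hX : IsSRW μ w X) :
    ∀ᵐ ω ∂μ, ∀ j : ℤ, (∃ᶠ n in atTop, X n ω = j) →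
      ∃ᶠ n in atTop, X n ω = j ∧ X (n + 1) ω = j - 1 := by
  filter_upwards [hX.neg.ae_frequently_up hw hm] with ω hω j hj
  refine (hω (-j) (hj.mono fun n hn => by rw [hn])).mono fun n hn => ?_
  omega

end Escape

section RayKnight

/-- Starting from `u` up-steps and `d` down-steps at a site, the expectation of `f` at the number
of up-steps made before the `m`-th down-step, where `f` is replaced by `1` as soon as `N` up-steps
occur. -/
def rkVal (w : ℤ → ℝ) (N m : ℕ) (f : ℕ → ℝ) (u d : ℕ) : ℝ :=
  if m ≤ d then f u
  else if N ≤ u then 1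
  else upProb w (u - d) * rkVal w N m f (u + 1) d + downProb w (u - d) * rkVal w N m f u (d + 1)
termination_by (N - u) + (m - d)

variable {w : ℤ → ℝ}

lemma rkVal_of_le {N m : ℕ} {f : ℕ → ℝ} {u d : ℕ} (h : m ≤ d) : rkVal w N m f u d = f u := by
  rw [rkVal, if_pos h]

lemma rkVal_of_overflow {N m : ℕ} {f : ℕ → ℝ} {u d : ℕ} (h : d < m) (hu : N ≤ u) :
    rkVal w N m f u d = 1 := by
  rw [rkVal, if_neg (by omega), if_pos hu]

lemma rkVal_rec {N m : ℕ} {f : ℕ → ℝ} {u d : ℕ} (h : d < m) (hu : u < N) :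
    rkVal w N m f u d = upProb w (u - d) * rkVal w N m f (u + 1) d +
      downProb w (u - d) * rkVal w N m f u (d + 1) := by
  rw [rkVal, if_neg (by omega), if_neg (by omega)]

/-- An induction principle for the recursion of `rkVal`. -/
lemma rk_induction (N m : ℕ) {P : ℕ → ℕ → Prop} (hd : ∀ u d, m ≤ d → P u d)
    (hu : ∀ u d, d < m → N ≤ u → P u d)
    (hs : ∀ u d, d < m → u < N → P (u + 1) d → P u (d + 1) → P u d) (u d : ℕ) : P u d := by
  induction h : (N - u) + (m - d) using Nat.strong_induction_on generalizing u d with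
  | _ k ih =>
    rcases Nat.lt_or_ge d m with h1 | h1
    · rcases Nat.lt_or_ge u N with h2 | h2
      · exact hs u d h1 h2 (ih _ (by omega) _ _ rfl) (ih _ (by omega) _ _ rfl)
      · exact hu u d h1 h2
    · exact hd u d h1

/-- A supersolution of the recursion dominates `rkVal`. -/
lemma rkVal_le (hw : ∀ z, 0 < w z) {N m : ℕ} {f : ℕ → ℝ} {S : ℕ → ℕ → ℝ}
    (hd : ∀ u d, m ≤ d → f u ≤ S u d) (hu : ∀ u d, d < m → N ≤ u → 1 ≤ S u d)
    (hs : ∀ u d, d < m → u < N →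
      upProb w (u - d) * S (u + 1) d + downProb w (u - d) * S u (d + 1) ≤ S u d) (u d : ℕ) :
    rkVal w N m f u d ≤ S u d := by
  induction u, d using rk_induction N m with
  | hd u d h => rw [rkVal_of_le h]; exact hd u d h
  | hu u d h h' => rw [rkVal_of_overflow h h']; exact hu u d h h'
  | hs u d h h' ih₁ ih₂ =>
    rw [rkVal_rec h h']
    refine le_trans (add_le_add ?_ ?_) (hs u d h h')
    · exact mul_le_mul_of_nonneg_left ih₁ (upProb_nonneg hw _)
    · exact mul_le_mul_of_nonneg_left ih₂ (downProb_pos hw _).le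

lemma rkVal_nonneg (hw : ∀ z, 0 < w z) {N m : ℕ} {f : ℕ → ℝ} (hf : ∀ u, 0 ≤ f u) (u d : ℕ) :
    0 ≤ rkVal w N m f u d := by
  induction u, d using rk_induction N m with
  | hd u d h => rw [rkVal_of_le h]; exact hf u
  | hu u d h h' => rw [rkVal_of_overflow h h']; exact zero_le_one
  | hs u d h h' ih₁ ih₂ =>
    rw [rkVal_rec h h']
    have := upProb_nonneg hw (u - d)
    have := (downProb_pos hw (u - d)).le
    positivity

lemma rkVal_eq_one (hw : ∀ z, 0 < w z) {N m : ℕ} {f : ℕ → ℝ} (u d : ℕ)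
    (hf : ∀ v, u ≤ v → f v = 1) : rkVal w N m f u d = 1 := by
  induction u, d using rk_induction N m with
  | hd u d h => rw [rkVal_of_le h]; exact hf u le_rfl
  | hu u d h h' => exact rkVal_of_overflow h h'
  | hs u d h h' ih₁ ih₂ =>
    rw [rkVal_rec h h', ih₁ fun v hv => hf v (by omega), ih₂ hf, mul_one, mul_one,
      upProb_add_downProb hw]

lemma rkVal_affine {N m : ℕ} (f g : ℕ → ℝ) {a b : ℝ} (hab : a + b = 1) (u d : ℕ) :
    rkVal w N m (fun v => a * f v + b * g v) u d =
      a * rkVal w N m f u d + b * rkVal w N m g u d := by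
  induction u, d using rk_induction N m with
  | hd u d h => simp only [rkVal_of_le h]
  | hu u d h h' => simp only [rkVal_of_overflow h h', mul_one, hab]
  | hs u d h h' ih₁ ih₂ =>
    simp only [rkVal_rec h h', ih₁, ih₂]
    ring

/-- A superharmonic bound for the expected number of up-steps before the `m`-th down-step. -/
def rkMean (w : ℤ → ℝ) (m u d : ℕ) : ℝ :=
  if m ≤ d then u
  else if m ≤ u then m + u - d
  else upProb w (u - d) * rkMean w m (u + 1) d + downProb w (u - d) * rkMean w m u (d + 1)
termination_by (m - u) + (m - d)

lemma rkMean_of_le {m u d : ℕ} (h : m ≤ d) : rkMean w m u d = u := by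
  rw [rkMean, if_pos h]

lemma rkMean_of_overflow {m u d : ℕ} (h : d ≤ m) (hu : m ≤ u) :
    rkMean w m u d = m + u - d := by
  rcases h.lt_or_eq with h | rfl
  · rw [rkMean, if_neg (by omega), if_pos hu]
  · rw [rkMean_of_le le_rfl]
    ring

lemma rkMean_rec {m u d : ℕ} (h : d < m) (hu : u < m) :
    rkMean w m u d = upProb w (u - d) * rkMean w m (u + 1) d +
      downProb w (u - d) * rkMean w m u (d + 1) := by
  rw [rkMean, if_neg (by omega), if_neg (by omega)]

lemma rkMean_add_swap (hw : ∀ z, 0 < w z) {m : ℕ} (u d : ℕ) (hu : u ≤ m) (hd : d ≤ m) :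
    rkMean w m u d + rkMean w m d u = 2 * m := by
  induction u, d using rk_induction m m with
  | hd u d h =>
    obtain rfl : d = m := by omega
    rw [rkMean_of_le h, rkMean_of_overflow hu le_rfl]
    ring
  | hu u d h h' =>
    obtain rfl : u = m := by omega
    rw [rkMean_of_le (u := d) h', rkMean_of_overflow hd le_rfl]
    ring
  | hs u d h h' ih₁ ih₂ =>
    have e : ((d : ℤ) - u) = -((u : ℤ) - d) := by ring
    rw [rkMean_rec h h', rkMean_rec h' h, e, upProb_neg, downProb_neg]
    have h1 := upProb_add_downProb hw (u - d)
    have h2 := ih₁ (by omega) hd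
    have h3 := ih₂ hu (by omega)
    linear_combination upProb w (u - d) * h2 + downProb w (u - d) * h3 + 2 * m * h1

lemma rkMean_zero_zero (hw : ∀ z, 0 < w z) (m : ℕ) : rkMean w m 0 0 = m := by
  have := rkMean_add_swap hw (m := m) 0 0 (by omega) (by omega)
  linarith

lemma rkMean_step_le (hw : ∀ z, 0 < w z) (hm : Monotone w) {m u d : ℕ} (h : d < m) :
    upProb w (u - d) * rkMean w m (u + 1) d + downProb w (u - d) * rkMean w m u (d + 1) ≤
      rkMean w m u d := by
  rcases Nat.lt_or_ge u m with hu | hu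
  · rw [rkMean_rec h hu]
  · rw [rkMean_of_overflow h.le hu, rkMean_of_overflow h.le (by omega), rkMean_of_overflow h hu]
    have h1 := upProb_add_downProb hw (u - d)
    have h2 := upProb_le_downProb hw hm (a := (u : ℤ) - d) (by omega)
    push_cast
    nlinarith

/-- The probability that all down-steps from the `d`-th to the `m`-th come before the first
up-step. -/
def noUpProb (w : ℤ → ℝ) (m u d : ℕ) : ℝ :=
  if u = 0 then ∏ i ∈ Finset.Ico d m, downProb w (-(i : ℤ)) else 0

lemma noUpProb_step {m u d : ℕ} (h : d < m) :
    upProb w (u - d) * noUpProb w m (u + 1) d + downProb w (u - d) * noUpProb w m u (d + 1) =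
      noUpProb w m u d := by
  unfold noUpProb
  by_cases hu : u = 0
  · subst hu
    simp [Finset.prod_eq_prod_Ico_succ_bot h]
  · simp [hu]

lemma noUpProb_le_one (hw : ∀ z, 0 < w z) (m u d : ℕ) : noUpProb w m u d ≤ 1 := by
  unfold noUpProb
  split_ifs
  · exact Finset.prod_le_one (fun i _ => (downProb_pos hw _).le)
      fun i _ => (downProb_lt_one hw _).le
  · exact zero_le_one

/-- The one-site bound behind the extinction of the Ray–Knight chain. -/
lemma rkVal_zero_zero_le (hw : ∀ z, 0 < w z) (hm : Monotone w) {N m : ℕ} (hN : 0 < N)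
    (hmN : m < N) {c : ℝ} (hc : 0 ≤ c) {f : ℕ → ℝ}
    (hf : ∀ u, f u ≤ u / N + if u = 0 then 0 else c) :
    rkVal w N m f 0 0 ≤ m / N + c * (1 - noUpProb w m 0 0) := by
  have hN' : (0 : ℝ) < N := by exact_mod_cast hN
  have h := rkVal_le hw (N := N) (m := m) (f := f)
    (S := fun u d => rkMean w m u d / N + c * (1 - noUpProb w m u d)) ?_ ?_ ?_ 0 0
  · simpa only [rkMean_zero_zero hw] using h
  · intro u d h
    rw [rkMean_of_le h]
    refine (hf u).trans (add_le_add le_rfl ?_)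
    unfold noUpProb
    split_ifs
    · simp [Finset.Ico_eq_empty_of_le h]
    · simp
  · intro u d h hu
    rw [rkMean_of_overflow h.le (by omega)]
    have h1 : (d : ℝ) < m := by exact_mod_cast h
    have h2 : (N : ℝ) ≤ u := by exact_mod_cast hu
    have h3 : 1 ≤ ((m : ℝ) + u - d) / N := by rw [one_le_div hN']; linarith
    have h4 := mul_nonneg hc (sub_nonneg.2 (noUpProb_le_one hw m u d))
    linarith
  · intro u d h _
    have h1 := upProb_add_downProb hw (u - d)
    have h2 := div_le_div_of_nonneg_right (rkMean_step_le hw hm (u := u) h) hN'.le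
    have h3 := noUpProb_step (w := w) (u := u) h
    rw [add_div, mul_div_assoc, mul_div_assoc] at h2
    have h4 : upProb w (u - d) * (c * (1 - noUpProb w m (u + 1) d)) +
        downProb w (u - d) * (c * (1 - noUpProb w m u (d + 1))) =
        c * (1 - noUpProb w m u d) := by
      linear_combination c * h1 - c * h3
    simp only [mul_add]
    linarith

/-- The number of up-steps from `j` before time `n` that precede the `m`-th down-step from `j`. -/
def upsBefore (x : ℕ → ℤ) (n : ℕ) (j : ℤ) (m : ℕ) : ℕ :=
  ((Finset.range n).filter fun i => x i = j ∧ x (i + 1) = j + 1 ∧ dirLocM x i j < m).card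

lemma upsBefore_succ (x : ℕ → ℤ) (n : ℕ) (j : ℤ) (m : ℕ) :
    upsBefore x (n + 1) j m = upsBefore x n j m +
      if x n = j ∧ x (n + 1) = j + 1 ∧ dirLocM x n j < m then 1 else 0 := by
  unfold upsBefore
  rw [Finset.range_add_one, Finset.filter_insert]
  split_ifs with h <;> simp

lemma upsBefore_congr {x y : ℕ → ℤ} {n : ℕ} (h : ∀ i ≤ n, x i = y i) (j : ℤ) (m : ℕ) :
    upsBefore x n j m = upsBefore y n j m := by
  unfold upsBefore
  congr 1
  apply Finset.filter_congr
  intro i hi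
  rw [Finset.mem_range] at hi
  rw [h i (by omega), h (i + 1) (by omega), dirLocM_congr fun l hl => h l (by omega)]

lemma upsBefore_eq {x : ℕ → ℤ} {n : ℕ} {j : ℤ} {m : ℕ} (h : dirLocM x n j < m) :
    upsBefore x n j m = dirLocP x n j := by
  unfold upsBefore dirLocP
  congr 1
  apply Finset.filter_congr
  intro i hi
  have : dirLocM x i j ≤ dirLocM x n j := dirLocM_mono x j (Finset.mem_range.1 hi).le
  simp only [and_congr_right_iff, and_iff_left_iff_imp]
  omega

lemma upsBefore_stepUp (x : ℕ → ℤ) (n : ℕ) (j : ℤ) (m : ℕ) :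
    upsBefore (stepUp x n) (n + 1) j m = upsBefore x n j m +
      if x n = j ∧ dirLocM x n j < m then 1 else 0 := by
  rw [upsBefore_succ, upsBefore_congr fun i hi => stepUp_of_le x hi, stepUp_succ,
    stepUp_of_le x le_rfl, dirLocM_stepUp_of_le x le_rfl]
  congr 2
  rw [eq_iff_iff]
  omega

lemma upsBefore_stepDown (x : ℕ → ℤ) (n : ℕ) (j : ℤ) (m : ℕ) :
    upsBefore (stepDown x n) (n + 1) j m = upsBefore x n j m := by
  rw [upsBefore_succ, upsBefore_congr fun i hi => stepDown_of_le x hi, stepDown_succ,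
    stepDown_of_le x le_rfl, if_neg (by omega), add_zero]

/-- Given the path up to time `n`, the conditional probability that the Ray–Knight chain started
from `m` down-steps at the site `j` survives `k` sites to the right. -/
def survival (w : ℤ → ℝ) (N : ℕ) (x : ℕ → ℤ) (n : ℕ) : ℕ → ℤ → ℕ → ℝ
  | 0, _, m => if m = 0 then 0 else 1
  | k + 1, j, m => if N ≤ m then 1 else
      rkVal w N m (survival w N x n k (j + 1)) (upsBefore x n j m) (min (dirLocM x n j) m)

lemma survival_congr (N : ℕ) {x y : ℕ → ℤ} {n : ℕ} (h : ∀ i ≤ n, x i = y i) (k : ℕ) (j : ℤ) :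
    survival w N x n k j = survival w N y n k j := by
  induction k generalizing j with
  | zero => rfl
  | succ k ih =>
    funext m
    rw [survival, survival, ih, upsBefore_congr h, dirLocM_congr h]

lemma survival_nonneg (hw : ∀ z, 0 < w z) (N : ℕ) (x : ℕ → ℤ) (n k : ℕ) (j : ℤ) (m : ℕ) :
    0 ≤ survival w N x n k j m := by
  induction k generalizing j m with
  | zero => rw [survival]; positivity
  | succ k ih =>
    rw [survival]
    split_ifs
    · exact zero_le_one
    · exact rkVal_nonneg hw (fun u => ih _ _) _ _

lemma survival_of_le {N : ℕ} (hN : 0 < N) (x : ℕ → ℤ) (n k : ℕ) (j : ℤ) {m : ℕ} (h : N ≤ m) :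
    survival w N x n k j m = 1 := by
  cases k with
  | zero => rw [survival, if_neg (by omega)]
  | succ k => rw [survival, if_pos h]

lemma survival_stepUp_of_lt (N : ℕ) (x : ℕ → ℤ) (n k : ℕ) (j : ℤ) (h : x n < j) :
    survival w N (stepUp x n) (n + 1) k j = survival w N x n k j := by
  induction k generalizing j with
  | zero => rfl
  | succ k ih =>
    funext m
    rw [survival, survival, ih _ (by omega), upsBefore_stepUp, dirLocM_stepUp,
      if_neg (c := x n = j ∧ _) (fun h' => h.ne h'.1), add_zero]

lemma survival_stepDown_of_lt (N : ℕ) (x : ℕ → ℤ) (n k : ℕ) (j : ℤ) (h : x n < j) :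
    survival w N (stepDown x n) (n + 1) k j = survival w N x n k j := by
  induction k generalizing j with
  | zero => rfl
  | succ k ih =>
    funext m
    rw [survival, survival, ih _ (by omega), upsBefore_stepDown, dirLocM_stepDown,
      if_neg h.ne, add_zero]

lemma survival_step (hw : ∀ z, 0 < w z) {N : ℕ} (hN : 0 < N) (x : ℕ → ℤ) (n k : ℕ) (j : ℤ)
    (m : ℕ) :
    upProb w (locDiff x n (x n)) * survival w N (stepUp x n) (n + 1) k j m +
      downProb w (locDiff x n (x n)) * survival w N (stepDown x n) (n + 1) k j m =
      survival w N x n k j m := by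
  have hp := upProb_add_downProb hw (locDiff x n (x n))
  induction k generalizing j m with
  | zero => simp only [survival]; rw [← add_mul, hp, one_mul]
  | succ k ih =>
    by_cases hm : N ≤ m
    · simp only [survival, if_pos hm, mul_one, hp]
    simp only [survival, if_neg hm]
    rw [upsBefore_stepUp, upsBefore_stepDown, dirLocM_stepUp, dirLocM_stepDown]
    by_cases hj : x n = j
    · rw [survival_stepUp_of_lt N x n k _ (by omega), survival_stepDown_of_lt N x n k _ (by omega)]
      subst hj
      simp only [true_and, if_true]
      by_cases hd : dirLocM x n (x n) < m
      · rw [if_pos hd, upsBefore_eq hd, min_eq_left hd.le, min_eq_left (by omega)]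
        rcases Nat.lt_or_ge (dirLocP x n (x n)) N with hu | hu
        · exact (rkVal_rec hd hu).symm
        · have h1 : ∀ v, dirLocP x n (x n) ≤ v → survival w N x n k (x n + 1) v = 1 := fun v hv =>
            survival_of_le hN x n k _ (hu.trans hv)
          rw [rkVal_eq_one hw _ _ h1, rkVal_eq_one hw _ _ h1,
            rkVal_eq_one hw _ _ fun v hv => h1 v (by omega), mul_one, mul_one, hp]
      · rw [if_neg hd, add_zero, min_eq_right (by omega), min_eq_right (by omega), ← add_mul, hp,
          one_mul]
    · rw [if_neg (by omega), if_neg hj, add_zero, add_zero, ← rkVal_affine _ _ hp]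
      simp_rw [ih]

/-- On the event that the walk is far to the right and has made few left steps, survival is
certain. -/
lemma survival_eq_one (hw : ∀ z, 0 < w z) (N : ℕ) {x : ℕ → ℤ} {n : ℕ}
    (hx : ∀ j, 0 ≤ j → j < x n → dirLocP x n j = dirLocM x n (j + 1) + 1) (k : ℕ) {j : ℤ}
    (hj : 0 ≤ j) {m : ℕ} (hm : dirLocM x n j < m) (hk : j + k ≤ x n) :
    survival w N x n k j m = 1 := by
  induction k generalizing j m with
  | zero => rw [survival, if_neg (by omega)]
  | succ k ih =>
    rw [survival]
    split_ifs
    · rfl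
    · refine rkVal_eq_one hw _ _ fun v hv => ih (by omega) ?_ (by push_cast at hk; omega)
      rw [upsBefore_eq hm, hx j hj (by push_cast at hk; omega)] at hv
      omega

/-- Extinction estimate for the Ray–Knight chain with no information revealed. -/
lemma survival_zero_le (hw : ∀ z, 0 < w z) (hm : Monotone w) {N : ℕ} (hN : 0 < N) (x : ℕ → ℤ)
    (k : ℕ) (j : ℤ) (m : ℕ) :
    survival w N x 0 k j m ≤ m / N + if m = 0 then 0 else (1 - noUpProb w N 0 0) ^ k := by
  have hN' : (0 : ℝ) < N := by exact_mod_cast hN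
  have hc : 0 ≤ 1 - noUpProb w N 0 0 := sub_nonneg.2 (noUpProb_le_one hw N 0 0)
  induction k generalizing j m with
  | zero =>
    rw [survival]
    split_ifs with h
    · simp [h]
    · have : (0 : ℝ) ≤ m / N := by positivity
      simpa using this
  | succ k ih =>
    rw [survival]
    by_cases h : N ≤ m
    · rw [if_pos h]
      have h1 : (1 : ℝ) ≤ m / N := by rw [one_le_div hN']; exact_mod_cast h
      have h2 : 0 ≤ if m = 0 then (0 : ℝ) else (1 - noUpProb w N 0 0) ^ (k + 1) := by
        split_ifs <;> positivity
      linarith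
    · rw [if_neg h, show upsBefore x 0 j m = 0 from rfl, dirLocM_zero, Nat.zero_min]
      refine (rkVal_zero_zero_le hw hm hN (by omega) (pow_nonneg hc k) fun u => ih (j + 1) u).trans
        (add_le_add le_rfl ?_)
      split_ifs with h0
      · subst h0
        simp [noUpProb]
      · rw [pow_succ]
        refine mul_le_mul_of_nonneg_left (sub_le_sub_left ?_ 1) (pow_nonneg hc k)
        simp only [noUpProb, if_true]
        exact Finset.prod_le_prod_of_subset_of_le_one
          (Finset.Ico_subset_Ico_right (by omega)) (fun i _ => (downProb_pos hw _).le)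
          fun i _ _ => (downProb_lt_one hw _).le

lemma noUpProb_pos (hw : ∀ z, 0 < w z) (m : ℕ) : 0 < noUpProb w m 0 0 := by
  simp only [noUpProb, if_true]
  exact Finset.prod_pos fun i _ => downProb_pos hw _

end RayKnight

section Recurrence

variable {Ω : Type*} [MeasurableSpace Ω] {μ : Measure Ω} {w : ℤ → ℝ} {X : ℕ → Ω → ℤ}

/-- Conservation of crossings for a nearest-neighbour path from the origin. -/
lemma IsNearestNeighbour.dirLocP_eq {x : ℕ → ℤ} (hx : IsNearestNeighbour x) (h0 : x 0 = 0)
    (n : ℕ) {j : ℤ} (hj : 0 ≤ j) :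
    dirLocP x n j = dirLocM x n (j + 1) + if j < x n then 1 else 0 := by
  induction n with
  | zero => rw [h0, if_neg (by omega), dirLocP_zero, dirLocM_zero]
  | succ n ih =>
    rw [dirLocP_succ, dirLocM_succ, ih]
    have := hx n
    split_ifs <;> omega

lemma lintegral_survival_le [IsProbabilityMeasure μ] (hw : ∀ z, 0 < w z) (hm : Monotone w)
    (hX : IsSRW μ w X) {N : ℕ} (hN : 0 < N) (n k : ℕ) (j : ℤ) (r : ℕ) :
    ∫⁻ ω, ENNReal.ofReal (survival w N (fun i => X i ω) n k j r) ∂μ ≤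
      ENNReal.ofReal (r / N + (1 - noUpProb w N 0 0) ^ k) := by
  induction n with
  | zero =>
    refine (lintegral_mono fun ω => ENNReal.ofReal_le_ofReal
      (survival_zero_le hw hm hN (fun i => X i ω) k j r)).trans ?_
    simp only [lintegral_const, measure_univ, mul_one]
    refine ENNReal.ofReal_le_ofReal (add_le_add le_rfl ?_)
    have := pow_nonneg (sub_nonneg.2 (noUpProb_le_one hw N 0 0)) k
    split_ifs <;> linarith
  | succ n ih =>
    rw [lintegral_step_eq hw hX n (fun x => survival w N x (n + 1) k j r)
      (fun x => survival w N x n k j r) (fun x => survival_nonneg hw _ _ _ _ _ _)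
      (fun x y h => by rw [survival_congr N h]) (fun x => survival_step hw hN x n k j r)]
    exact ih

lemma IsSRW.ae_not_tendsto_atTop [IsProbabilityMeasure μ] (hw : ∀ z, 0 < w z) (hm : Monotone w)
    (hX : IsSRW μ w X) : ∀ᵐ ω ∂μ, ¬ Tendsto (fun n => X n ω) atTop atTop := by
  have key : ∀ r : ℕ, ∀ᵐ ω ∂μ, ¬ (IsNearestNeighbour (fun n => X n ω) ∧ X 0 ω = 0 ∧
      Tendsto (fun n => X n ω) atTop atTop ∧
      ∀ᶠ n in atTop, dirLocM (fun i => X i ω) n 1 < r) := by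
    intro r
    rw [ae_iff]
    simp only [not_not]
    set T : Set Ω := {ω | IsNearestNeighbour (fun n => X n ω) ∧ X 0 ω = 0 ∧
      Tendsto (fun n => X n ω) atTop atTop ∧ ∀ᶠ n in atTop, dirLocM (fun i => X i ω) n 1 < r}
      with hT
    have hb : ∀ N : ℕ, 0 < N → ∀ k : ℕ,
        μ T ≤ ENNReal.ofReal (r / N + (1 - noUpProb w N 0 0) ^ k) := by
      intro N hN k
      set A : ℕ → Set Ω := fun n => {ω | IsNearestNeighbour (fun n => X n ω) ∧ X 0 ω = 0 ∧
        1 + (k : ℤ) ≤ X n ω ∧ dirLocM (fun i => X i ω) n 1 < r} with hA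
      have hAn : ∀ n ≥ 0, μ (A n) ≤ ENNReal.ofReal (r / N + (1 - noUpProb w N 0 0) ^ k) := by
        intro n _
        refine le_trans ?_ (lintegral_survival_le hw hm hX hN n k 1 r)
        refine measure_le_lintegral_of_one_le (measurable_of_dependsOn hX.1 n
          (fun x => survival w N x n k 1 r)
          (fun x y h => by rw [survival_congr N h])).ennreal_ofReal ?_
        rintro ω ⟨h1, h2, h3, h4⟩
        rw [survival_eq_one hw N (fun j hj hj' => by
          rw [h1.dirLocP_eq h2 n hj, if_pos hj']) k zero_le_one h4 h3, ENNReal.ofReal_one]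
      refine (measure_mono ?_).trans (measure_eventually_le 0 hAn)
      rintro ω ⟨h1, h2, h3, h4⟩
      filter_upwards [h3.eventually_ge_atTop (1 + (k : ℤ)), h4] with n h5 h6
      exact ⟨h1, h2, h5, h6⟩
    have hN : ∀ N : ℕ, μ T ≤ ENNReal.ofReal (r / ((N : ℝ) + 1)) := by
      intro N
      have h0 := sub_nonneg.2 (noUpProb_le_one hw (N + 1) 0 0)
      have h1 : 1 - noUpProb w (N + 1) 0 0 < 1 := sub_lt_self _ (noUpProb_pos hw _)
      have hl := ENNReal.tendsto_ofReal
        ((tendsto_pow_atTop_nhds_zero_of_lt_one h0 h1).const_add ((r : ℝ) / ((N : ℝ) + 1)))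
      rw [add_zero] at hl
      exact ge_of_tendsto' hl fun k => by exact_mod_cast hb (N + 1) N.succ_pos k
    have hl : Tendsto (fun N : ℕ => ENNReal.ofReal (r / ((N : ℝ) + 1))) atTop (𝓝 0) := by
      rw [← ENNReal.ofReal_zero]
      refine ENNReal.tendsto_ofReal (tendsto_const_nhds.div_atTop ?_)
      exact tendsto_atTop_add_const_right _ _ tendsto_natCast_atTop_atTop
    exact le_antisymm (ge_of_tendsto' hl hN) bot_le
  filter_upwards [ae_all_iff.2 key, hX.ae_isNearestNeighbour hw, hX.ae_zero] with ω hω h1 h2 h3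
  obtain ⟨n₀, hn₀⟩ := eventually_atTop.1 (h3.eventually_ge_atTop 2)
  refine hω (dirLocM (fun i => X i ω) n₀ 1 + 1) ⟨h1, h2, h3, eventually_atTop.2 ⟨n₀, ?_⟩⟩
  intro n hn
  rw [Nat.lt_succ_iff]
  induction n, hn using Nat.le_induction with
  | base => rfl
  | succ n hn ih =>
    have := hn₀ n hn
    rwa [dirLocM_succ, if_neg (by omega), add_zero]

lemma IsNearestNeighbour.pos_of_ne_zero {x : ℕ → ℤ} (hx : IsNearestNeighbour x) {n₀ : ℕ}
    (h : ∀ n ≥ n₀, x n ≠ 0) (h0 : 0 < x n₀) : ∀ n ≥ n₀, 0 < x n := by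
  intro n hn
  induction n, hn using Nat.le_induction with
  | base => exact h0
  | succ n hn ih =>
    have h1 := hx n
    have h2 := h (n + 1) (by omega)
    omega

lemma IsNearestNeighbour.neg {x : ℕ → ℤ} (hx : IsNearestNeighbour x) :
    IsNearestNeighbour fun n => -x n := by
  intro n
  have := hx n
  dsimp only
  omega

/-- A nearest-neighbour path which eventually leaves every site and is positive at a late time
tends to infinity. -/
lemma IsNearestNeighbour.tendsto_atTop {x : ℕ → ℤ} (hx : IsNearestNeighbour x)
    (h : ∀ j, ∀ᶠ n in atTop, x n ≠ j) {n₀ : ℕ} (h0 : ∀ n ≥ n₀, x n ≠ 0) (hp : 0 < x n₀) :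
    Tendsto x atTop atTop := by
  refine Filter.tendsto_atTop.2 fun b => ?_
  have h1 : ∀ᶠ n in atTop, ∀ j ∈ Finset.Icc 0 b, x n ≠ j :=
    (Filter.eventually_all_finset _).2 fun j _ => h j
  filter_upwards [h1, eventually_ge_atTop n₀] with n h2 h3
  have h4 := hx.pos_of_ne_zero h0 hp n h3
  by_contra hcon
  exact h2 (x n) (Finset.mem_Icc.2 ⟨h4.le, by omega⟩) rfl

lemma IsNearestNeighbour.frequently_eq {x : ℕ → ℤ} (hx : IsNearestNeighbour x)
    (ht : ¬ Tendsto x atTop atTop) (hb : ¬ Tendsto (fun n => -x n) atTop atTop)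
    (hu : ∀ j : ℤ, (∃ᶠ n in atTop, x n = j) → ∃ᶠ n in atTop, x n = j ∧ x (n + 1) = j + 1)
    (hd : ∀ j : ℤ, (∃ᶠ n in atTop, x n = j) → ∃ᶠ n in atTop, x n = j ∧ x (n + 1) = j - 1)
    (j : ℤ) : ∃ᶠ n in atTop, x n = j := by
  have hex : ∃ j, ∃ᶠ n in atTop, x n = j := by
    by_contra hcon
    simp only [not_exists, not_frequently] at hcon
    obtain ⟨n₀, hn₀⟩ := eventually_atTop.1 (hcon 0)
    rcases lt_or_gt_of_ne (hn₀ n₀ le_rfl) with h | h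
    · refine hb (hx.neg.tendsto_atTop (fun j => ?_) (n₀ := n₀) (fun n hn => ?_) (by omega))
      · filter_upwards [hcon (-j)] with n hn
        omega
      · have := hn₀ n hn
        omega
    · exact ht (hx.tendsto_atTop hcon hn₀ h)
  obtain ⟨j₀, hj₀⟩ := hex
  induction j using Int.inductionOn' (b := j₀) with
  | zero => exact hj₀
  | succ k _ ih =>
    exact (tendsto_add_atTop_nat 1).frequently ((hu k ih).mono fun n hn => hn.2)
  | pred k _ ih =>
    exact (tendsto_add_atTop_nat 1).frequently ((hd k ih).mono fun n hn => hn.2)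

/-- The walk is recurrent. -/
lemma IsSRW.ae_frequently_eq [IsProbabilityMeasure μ] (hw : ∀ z, 0 < w z) (hm : Monotone w)
    (hX : IsSRW μ w X) : ∀ᵐ ω ∂μ, ∀ j : ℤ, ∃ᶠ n in atTop, X n ω = j := by
  filter_upwards [hX.ae_isNearestNeighbour hw, hX.ae_not_tendsto_atTop hw hm,
    hX.neg.ae_not_tendsto_atTop hw hm, hX.ae_frequently_up hw hm, hX.ae_frequently_down hw hm]
    with ω h1 h2 h3 h4 h5
  exact h1.frequently_eq h2 h3 h4 h5

end Recurrence

section Cylinder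

/-- The number of jumps out of the site `k` before time `n`. -/
def totalLoc (x : ℕ → ℤ) (n : ℕ) (k : ℤ) : ℕ := dirLocP x n k + dirLocM x n k

/-- Up to time `n`, the first `L` jumps out of `j` agree with the prescription `y`. -/
def Agrees (L : ℕ) (y : ℕ → ℤ) (x : ℕ → ℤ) (n : ℕ) (j : ℤ) : Prop :=
  ∀ i ≤ n, totalLoc x i j ≤ L → locDiff x i j = y (totalLoc x i j)

open scoped Classical in
/-- The conditional probability, given the path up to time `n`, that the first `L` values of the
process at the site `j` are given by `y`. -/
def siteWeight (w : ℤ → ℝ) (L : ℕ) (y : ℕ → ℤ) (x : ℕ → ℤ) (n : ℕ) (j : ℤ) : ℝ :=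
  if Agrees L y x n j then ∏ l ∈ Finset.Ico (totalLoc x n j) L, XiKer w (y l) (y (l + 1)) else 0

variable {w : ℤ → ℝ}

lemma totalLoc_mono (x : ℕ → ℤ) (k : ℤ) : Monotone fun n => totalLoc x n k :=
  (dirLocP_mono x k).add (dirLocM_mono x k)

lemma totalLoc_congr {x y : ℕ → ℤ} {n : ℕ} (h : ∀ i ≤ n, x i = y i) (k : ℤ) :
    totalLoc x n k = totalLoc y n k := by
  rw [totalLoc, totalLoc, dirLocP_congr h, dirLocM_congr h]

lemma totalLoc_succ_le (x : ℕ → ℤ) (n : ℕ) (k : ℤ) :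
    totalLoc x (n + 1) k ≤ totalLoc x n k + 1 := by
  unfold totalLoc
  rw [dirLocP_succ, dirLocM_succ]
  split_ifs <;> omega

lemma agrees_congr {L : ℕ} {y : ℕ → ℤ} {x x' : ℕ → ℤ} {n : ℕ} (h : ∀ i ≤ n, x i = x' i) (j : ℤ) :
    Agrees L y x n j ↔ Agrees L y x' n j := by
  refine forall₂_congr fun i hi => ?_
  have h' : ∀ l ≤ i, x l = x' l := fun l hl => h l (hl.trans hi)
  rw [totalLoc_congr h', locDiff_congr h']

lemma agrees_succ {L : ℕ} {y : ℕ → ℤ} {x : ℕ → ℤ} {n : ℕ} {j : ℤ} :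
    Agrees L y x (n + 1) j ↔ Agrees L y x n j ∧
      (totalLoc x (n + 1) j ≤ L → locDiff x (n + 1) j = y (totalLoc x (n + 1) j)) := by
  refine ⟨fun h => ⟨fun i hi => h i (by omega), h _ le_rfl⟩, fun h i hi => ?_⟩
  rcases Nat.lt_or_ge n i with h1 | h1
  · obtain rfl : i = n + 1 := by omega
    exact h.2
  · exact h.1 i h1

lemma siteWeight_congr (L : ℕ) (y : ℕ → ℤ) {x x' : ℕ → ℤ} {n : ℕ} (h : ∀ i ≤ n, x i = x' i)
    (j : ℤ) : siteWeight w L y x n j = siteWeight w L y x' n j := by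
  unfold siteWeight
  rw [totalLoc_congr h]
  classical exact if_congr (agrees_congr h j) rfl rfl

lemma xiKer_eq (w : ℤ → ℝ) (a b : ℤ) : XiKer w a b =
    if b = a + 1 then upProb w a else if b = a - 1 then downProb w a else 0 := rfl

lemma xiKer_nonneg (hw : ∀ z, 0 < w z) (a b : ℤ) : 0 ≤ XiKer w a b := by
  rw [xiKer_eq]
  split_ifs
  · exact upProb_nonneg hw a
  · exact (downProb_pos hw a).le
  · exact le_rfl

lemma xiKer_le_one (hw : ∀ z, 0 < w z) (a b : ℤ) : XiKer w a b ≤ 1 := by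
  have := upProb_add_downProb hw a
  have := upProb_nonneg hw a
  have := (downProb_pos hw a).le
  rw [xiKer_eq]
  split_ifs <;> linarith

lemma siteWeight_nonneg (hw : ∀ z, 0 < w z) (L : ℕ) (y x : ℕ → ℤ) (n : ℕ) (j : ℤ) :
    0 ≤ siteWeight w L y x n j := by
  unfold siteWeight
  split_ifs
  · exact Finset.prod_nonneg fun l _ => xiKer_nonneg hw _ _
  · exact le_rfl

lemma siteWeight_le_one (hw : ∀ z, 0 < w z) (L : ℕ) (y x : ℕ → ℤ) (n : ℕ) (j : ℤ) :
    siteWeight w L y x n j ≤ 1 := by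
  unfold siteWeight
  split_ifs
  · exact Finset.prod_le_one (fun l _ => xiKer_nonneg hw _ _) fun l _ => xiKer_le_one hw _ _
  · exact zero_le_one

lemma totalLoc_stepUp (x : ℕ → ℤ) (n : ℕ) (k : ℤ) :
    totalLoc (stepUp x n) (n + 1) k = totalLoc x n k + if x n = k then 1 else 0 := by
  rw [totalLoc, totalLoc, dirLocP_stepUp, dirLocM_stepUp]
  ring

lemma totalLoc_stepDown (x : ℕ → ℤ) (n : ℕ) (k : ℤ) :
    totalLoc (stepDown x n) (n + 1) k = totalLoc x n k + if x n = k then 1 else 0 := by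
  rw [totalLoc, totalLoc, dirLocP_stepDown, dirLocM_stepDown]
  ring

lemma locDiff_stepUp (x : ℕ → ℤ) (n : ℕ) (k : ℤ) :
    locDiff (stepUp x n) (n + 1) k = locDiff x n k + if x n = k then 1 else 0 := by
  rw [locDiff, locDiff, dirLocP_stepUp, dirLocM_stepUp]
  push_cast
  ring

lemma locDiff_stepDown (x : ℕ → ℤ) (n : ℕ) (k : ℤ) :
    locDiff (stepDown x n) (n + 1) k = locDiff x n k - if x n = k then 1 else 0 := by
  rw [locDiff, locDiff, dirLocP_stepDown, dirLocM_stepDown]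
  push_cast
  ring

lemma siteWeight_stepUp_of_ne (L : ℕ) (y x : ℕ → ℤ) (n : ℕ) {j : ℤ} (h : x n ≠ j) :
    siteWeight w L y (stepUp x n) (n + 1) j = siteWeight w L y x n j := by
  have h1 : Agrees L y (stepUp x n) (n + 1) j ↔ Agrees L y x n j := by
    rw [agrees_succ, agrees_congr fun i hi => stepUp_of_le x hi, totalLoc_stepUp, locDiff_stepUp,
      if_neg h, if_neg h, add_zero, add_zero, and_iff_left_iff_imp]
    exact fun h2 => h2 n le_rfl
  unfold siteWeight
  rw [totalLoc_stepUp, if_neg h, add_zero]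
  classical exact if_congr h1 rfl rfl

lemma siteWeight_stepDown_of_ne (L : ℕ) (y x : ℕ → ℤ) (n : ℕ) {j : ℤ} (h : x n ≠ j) :
    siteWeight w L y (stepDown x n) (n + 1) j = siteWeight w L y x n j := by
  have h1 : Agrees L y (stepDown x n) (n + 1) j ↔ Agrees L y x n j := by
    rw [agrees_succ, agrees_congr fun i hi => stepDown_of_le x hi, totalLoc_stepDown,
      locDiff_stepDown, if_neg h, if_neg h, add_zero, sub_zero, and_iff_left_iff_imp]
    exact fun h2 => h2 n le_rfl
  unfold siteWeight
  rw [totalLoc_stepDown, if_neg h, add_zero]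
  classical exact if_congr h1 rfl rfl

lemma siteWeight_step (hw : ∀ z, 0 < w z) (L : ℕ) (y x : ℕ → ℤ) (n : ℕ) :
    upProb w (locDiff x n (x n)) * siteWeight w L y (stepUp x n) (n + 1) (x n) +
      downProb w (locDiff x n (x n)) * siteWeight w L y (stepDown x n) (n + 1) (x n) =
      siteWeight w L y x n (x n) := by
  have hu : Agrees L y (stepUp x n) (n + 1) (x n) ↔ Agrees L y x n (x n) ∧
      (totalLoc x n (x n) + 1 ≤ L →
        locDiff x n (x n) + 1 = y (totalLoc x n (x n) + 1)) := by
    rw [agrees_succ, agrees_congr fun i hi => stepUp_of_le x hi, totalLoc_stepUp, locDiff_stepUp,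
      if_pos rfl, if_pos rfl]
  have hd : Agrees L y (stepDown x n) (n + 1) (x n) ↔ Agrees L y x n (x n) ∧
      (totalLoc x n (x n) + 1 ≤ L →
        locDiff x n (x n) - 1 = y (totalLoc x n (x n) + 1)) := by
    rw [agrees_succ, agrees_congr fun i hi => stepDown_of_le x hi, totalLoc_stepDown,
      locDiff_stepDown, if_pos rfl, if_pos rfl]
  classical
  unfold siteWeight
  rw [totalLoc_stepUp, totalLoc_stepDown, if_pos rfl]
  by_cases hA : Agrees L y x n (x n)
  swap
  · rw [if_neg fun h => hA (hu.1 h).1, if_neg fun h => hA (hd.1 h).1, if_neg hA, mul_zero,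
      mul_zero, add_zero]
  have hA' := hA n le_rfl
  rw [if_pos hA]
  rcases Nat.lt_or_ge (totalLoc x n (x n)) L with hL | hL
  · have hu' : Agrees L y (stepUp x n) (n + 1) (x n) ↔
        y (totalLoc x n (x n) + 1) = locDiff x n (x n) + 1 :=
      hu.trans ⟨fun h => (h.2 hL).symm, fun h => ⟨hA, fun _ => h.symm⟩⟩
    have hd' : Agrees L y (stepDown x n) (n + 1) (x n) ↔
        y (totalLoc x n (x n) + 1) = locDiff x n (x n) - 1 :=
      hd.trans ⟨fun h => (h.2 hL).symm, fun h => ⟨hA, fun _ => h.symm⟩⟩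
    rw [Finset.prod_eq_prod_Ico_succ_bot hL, xiKer_eq, ← hA' hL.le, if_congr hu' rfl rfl,
      if_congr hd' rfl rfl]
    set a := locDiff x n (x n)
    set b := y (totalLoc x n (x n) + 1)
    rcases eq_or_ne b (a + 1) with h | h
    · rw [if_pos h, if_neg (by omega), if_pos h, mul_zero, add_zero]
    · rw [if_neg h, if_neg h, mul_zero, zero_add]
      rcases eq_or_ne b (a - 1) with h' | h'
      · rw [if_pos h', if_pos h']
      · rw [if_neg h', if_neg h', mul_zero, zero_mul]
  · rw [Finset.Ico_eq_empty_of_le hL, Finset.Ico_eq_empty_of_le (by omega),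
      if_pos (hu.2 ⟨hA, fun h => absurd h (by omega)⟩),
      if_pos (hd.2 ⟨hA, fun h => absurd h (by omega)⟩), ← add_mul, upProb_add_downProb hw, one_mul]

lemma prod_siteWeight_step (hw : ∀ z, 0 < w z) (S : Finset ℤ) (L : ℤ → ℕ) (y : ℤ → ℕ → ℤ)
    (x : ℕ → ℤ) (n : ℕ) :
    upProb w (locDiff x n (x n)) * ∏ j ∈ S, siteWeight w (L j) (y j) (stepUp x n) (n + 1) j +
      downProb w (locDiff x n (x n)) *
        ∏ j ∈ S, siteWeight w (L j) (y j) (stepDown x n) (n + 1) j =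
      ∏ j ∈ S, siteWeight w (L j) (y j) x n j := by
  have hu : ∀ T : Finset ℤ, x n ∉ T →
      ∏ j ∈ T, siteWeight w (L j) (y j) (stepUp x n) (n + 1) j =
        ∏ j ∈ T, siteWeight w (L j) (y j) x n j := fun T hT =>
    Finset.prod_congr rfl fun j hj =>
      siteWeight_stepUp_of_ne _ _ _ _ fun h => hT (h ▸ hj)
  have hd : ∀ T : Finset ℤ, x n ∉ T →
      ∏ j ∈ T, siteWeight w (L j) (y j) (stepDown x n) (n + 1) j =
        ∏ j ∈ T, siteWeight w (L j) (y j) x n j := fun T hT =>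
    Finset.prod_congr rfl fun j hj =>
      siteWeight_stepDown_of_ne _ _ _ _ fun h => hT (h ▸ hj)
  by_cases h : x n ∈ S
  · rw [← Finset.mul_prod_erase _ _ h, ← Finset.mul_prod_erase _ _ h,
      ← Finset.mul_prod_erase _ _ h, hu _ (Finset.notMem_erase _ _),
      hd _ (Finset.notMem_erase _ _), ← siteWeight_step hw]
    ring
  · rw [hu _ h, hd _ h, ← add_mul, upProb_add_downProb hw, one_mul]

lemma siteWeight_zero (w : ℤ → ℝ) (L : ℕ) (y x : ℕ → ℤ) (j : ℤ) :
    siteWeight w L y x 0 j = (if y 0 = 0 then (1 : ℝ) else 0) *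
      ∏ l ∈ Finset.range L, XiKer w (y l) (y (l + 1)) := by
  have h : Agrees L y x 0 j ↔ y 0 = 0 := by
    refine ⟨fun h => (h 0 le_rfl (Nat.zero_le _)).symm, fun h i hi _ => ?_⟩
    obtain rfl : i = 0 := by omega
    exact h.symm
  unfold siteWeight
  simp only [h, show totalLoc x 0 j = 0 from rfl, Nat.Ico_zero_eq_range, ite_mul, one_mul, zero_mul]

lemma totalLoc_gammaT {x : ℕ → ℤ} {j : ℤ} {l n : ℕ} (h : l ≤ totalLoc x n j) :
    gammaT x j l ≤ n ∧ totalLoc x (gammaT x j l) j = l := by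
  have hne : {n | l ≤ dirLocP x n j + dirLocM x n j}.Nonempty := ⟨n, h⟩
  refine ⟨Nat.sInf_le h, le_antisymm ?_ (Nat.sInf_mem hne)⟩
  rcases Nat.eq_zero_or_pos (gammaT x j l) with h0 | h0
  · rw [h0]
    exact Nat.zero_le _
  · have h1 : ¬ l ≤ totalLoc x (gammaT x j l - 1) j :=
      Nat.notMem_of_lt_sInf (s := {n | l ≤ dirLocP x n j + dirLocM x n j})
        (Nat.sub_lt h0 Nat.one_pos)
    have h2 := totalLoc_succ_le x (gammaT x j l - 1) j
    rw [Nat.sub_add_cancel h0] at h2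
    omega

lemma agrees_iff_xiProc {L : ℕ} {y x : ℕ → ℤ} {n : ℕ} {j : ℤ} (h : L ≤ totalLoc x n j) :
    Agrees L y x n j ↔ ∀ l ≤ L, xiProc x j l = y l := by
  constructor
  · intro hA l hl
    obtain ⟨h1, h2⟩ := totalLoc_gammaT (hl.trans h)
    have h3 := hA _ h1 (h2.trans_le hl)
    rwa [h2] at h3
  · intro hxi i hi hL
    rw [← hxi _ hL]
    obtain ⟨h1, h2⟩ := totalLoc_gammaT (x := x) (j := j) (n := i) le_rfl
    have h3 : dirLocP x _ j ≤ dirLocP x _ j := dirLocP_mono x j h1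
    have h4 : dirLocM x _ j ≤ dirLocM x _ j := dirLocM_mono x j h1
    simp only [totalLoc] at h1 h2 h3 h4 ⊢
    unfold locDiff xiProc
    omega

lemma IsNearestNeighbour.tendsto_totalLoc {x : ℕ → ℤ} (hx : IsNearestNeighbour x) {j : ℤ}
    (h : ∃ᶠ n in atTop, x n = j) : Tendsto (fun n => totalLoc x n j) atTop atTop := by
  refine tendsto_atTop_atTop_of_monotone (totalLoc_mono x j) fun b => ?_
  induction b with
  | zero => exact ⟨0, Nat.zero_le _⟩
  | succ b ih =>
    obtain ⟨a, ha⟩ := ih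
    obtain ⟨n, hn, hxn⟩ := frequently_atTop.1 h a
    have h1 : totalLoc x a j ≤ totalLoc x n j := totalLoc_mono x j hn
    refine ⟨n + 1, ?_⟩
    unfold totalLoc at *
    have h2 := hx n
    rw [dirLocP_succ, dirLocM_succ]
    split_ifs <;> omega

open scoped Classical in
lemma eventually_prod_siteWeight {x : ℕ → ℤ} (hx : IsNearestNeighbour x)
    (h : ∀ j, ∃ᶠ n in atTop, x n = j) (S : Finset ℤ) (L : ℤ → ℕ) (y : ℤ → ℕ → ℤ) :
    ∀ᶠ n in atTop, ∏ j ∈ S, siteWeight w (L j) (y j) x n j =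
      if ∀ j ∈ S, ∀ l ≤ L j, xiProc x j l = y j l then 1 else 0 := by
  have h1 : ∀ᶠ n in atTop, ∀ j ∈ S, L j ≤ totalLoc x n j :=
    (Filter.eventually_all_finset _).2 fun j _ =>
      (hx.tendsto_totalLoc (h j)).eventually_ge_atTop (L j)
  filter_upwards [h1] with n hn
  have h2 : ∀ j ∈ S, siteWeight w (L j) (y j) x n j =
      if ∀ l ≤ L j, xiProc x j l = y j l then 1 else 0 := by
    intro j hj
    unfold siteWeight
    simp only [agrees_iff_xiProc (hn j hj), Finset.Ico_eq_empty_of_le (hn j hj),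
      Finset.prod_empty]
  rw [Finset.prod_congr rfl h2, Finset.prod_ite_zero, Finset.prod_const_one]

end Cylinder

/-- the processes `(l ↦ ξ_j(l))_{j ∈ ℤ}` are independent Markov chains,
each started at `0` with transition kernel `XiKer w`.  This is expressed through the
joint cylinder probabilities over any finite collection of sites. -/
theorem stmt_12 (w : ℤ → ℝ) (hw : GoodWeight w)
    {Ω : Type*} [MeasurableSpace Ω] (μ : Measure Ω) [IsProbabilityMeasure μ]
    (X : ℕ → Ω → ℤ) (hX : IsSRW μ w X) :
    ∀ (S : Finset ℤ) (L : ℤ → ℕ) (y : ℤ → ℕ → ℤ),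
      μ {ω | ∀ j ∈ S, ∀ l ≤ L j, xiProc (fun n => X n ω) j l = y j l} =
        ∏ j ∈ S, ENNReal.ofReal ((if y j 0 = 0 then (1 : ℝ) else 0) *
          ∏ l ∈ Finset.range (L j), XiKer w (y j l) (y j (l + 1))) := by
  classical
  intro S L y
  have hw0 := hw.1
  have hm : Monotone w := monotone_int_of_le_succ hw.2.1
  set F : ℕ → (ℕ → ℤ) → ℝ := fun n x => ∏ j ∈ S, siteWeight w (L j) (y j) x n j with hF
  have hF0 : ∀ n x, 0 ≤ F n x := fun n x =>
    Finset.prod_nonneg fun j _ => siteWeight_nonneg hw0 _ _ _ _ _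
  have hF1 : ∀ n x, F n x ≤ 1 := fun n x =>
    Finset.prod_le_one (fun j _ => siteWeight_nonneg hw0 _ _ _ _ _)
      fun j _ => siteWeight_le_one hw0 _ _ _ _ _
  have hFc : ∀ n (x x' : ℕ → ℤ), (∀ i ≤ n, x i = x' i) → F n x = F n x' := fun n x x' h =>
    Finset.prod_congr rfl fun j _ => siteWeight_congr _ _ h j
  have hFm : ∀ n, Measurable fun ω => ENNReal.ofReal (F n fun i => X i ω) := fun n =>
    (measurable_of_dependsOn hX.1 n (F n) (hFc n)).ennreal_ofReal
  set E : Set Ω := {ω | ∀ j ∈ S, ∀ l ≤ L j, xiProc (fun n => X n ω) j l = y j l} with hE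
  have hconst : ∀ n, ∫⁻ ω, ENNReal.ofReal (F n fun i => X i ω) ∂μ =
      ∏ j ∈ S, ENNReal.ofReal ((if y j 0 = 0 then (1 : ℝ) else 0) *
          ∏ l ∈ Finset.range (L j), XiKer w (y j l) (y j (l + 1))) := by
    intro n
    induction n with
    | zero =>
      simp only [hF, siteWeight_zero, lintegral_const, measure_univ, mul_one]
      refine ENNReal.ofReal_prod_of_nonneg fun j _ => ?_
      rw [← siteWeight_zero w (L j) (y j) (y j) j]
      exact siteWeight_nonneg hw0 _ _ _ _ _
    | succ n ih =>
      rw [lintegral_step_eq hw0 hX n (F (n + 1)) (F n) (hF0 _) (hFc _)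
        (fun x => prod_siteWeight_step hw0 S L y x n), ih]
  have hlim : ∀ᵐ ω ∂μ, Tendsto (fun n => ENNReal.ofReal (F n fun i => X i ω)) atTop
      (𝓝 (E.indicator 1 ω)) := by
    filter_upwards [hX.ae_isNearestNeighbour hw0, hX.ae_frequently_eq hw0 hm] with ω h1 h2
    refine tendsto_const_nhds.congr' ?_
    filter_upwards [eventually_prod_siteWeight (w := w) h1 h2 S L y] with n hn
    simp only [hF, hn, Set.indicator_apply, hE, Set.mem_ofPred_eq, Pi.one_apply]
    split_ifs <;> simp
  have hEm : NullMeasurableSet E μ := by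
    have h1 : AEMeasurable (E.indicator (1 : Ω → ℝ≥0∞)) μ :=
      aemeasurable_of_tendsto_metrizable_ae' (fun n => (hFm n).aemeasurable) hlim
    have h2 : E = E.indicator (1 : Ω → ℝ≥0∞) ⁻¹' {1} := by
      ext ω
      simp [Set.indicator_apply]
    rw [h2]
    exact h1.nullMeasurableSet_preimage (measurableSet_singleton 1)
  have hdom := tendsto_lintegral_of_dominated_convergence (μ := μ) (fun _ => 1) hFm
    (fun n => Eventually.of_forall fun ω => ENNReal.ofReal_le_one.2 (hF1 n _)) (by simp) hlim
  simp only [hconst] at hdom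
  rw [lintegral_indicator_one₀ hEm] at hdom
  exact (tendsto_nhds_unique hdom tendsto_const_nhds)
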